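/- Let X be a C*-correspondence over A. For any closed ideal I of A, the ideal X_{-∞}(I) = lim_{n→∞} X_{-n}(I), where X_0(I)=I and X_{-(n+1)}(I) = X_{-n}(I) + J_X ∩ X⁻¹(X_{-n}(I)), is the smallest negatively invariant ideal of A containing I. -/

import Mathlib

noncomputable section

/-- A (right) Hilbert C*-module over a C*-algebra `A`. -/
class HilbertModule (A : Type*) [CStarAlgebra A] (X : Type*)
    [NormedAddCommGroup X] [NormedSpace ℂ X] : Type _ where
  rsmul : X → A → X
  inner : X → X → A
  rsmul_add_left : ∀ (x y : X) (a : A), rsmul (x + y) a = rsmul x a + rsmul y a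
  rsmul_add_right : ∀ (x : X) (a b : A), rsmul x (a + b) = rsmul x a + rsmul x b
  rsmul_rsmul : ∀ (x : X) (a b : A), rsmul (rsmul x a) b = rsmul x (a * b)
  rsmul_csmul_left : ∀ (c : ℂ) (x : X) (a : A), rsmul (c • x) a = c • rsmul x a
  rsmul_csmul_right : ∀ (c : ℂ) (x : X) (a : A), rsmul x (c • a) = c • rsmul x a
  inner_add_left : ∀ (x y z : X), inner (x + y) z = inner x z + inner y z
  inner_add_right : ∀ (x y z : X), inner x (y + z) = inner x y + inner x z
  inner_csmul_right : ∀ (c : ℂ) (x y : X), inner x (c • y) = c • inner x y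
  star_inner : ∀ (x y : X), star (inner x y) = inner y x
  inner_rsmul_right : ∀ (x y : X) (a : A), inner x (rsmul y a) = inner x y * a
  inner_self_isPositive : ∀ x : X, ∃ b : A, inner x x = star b * b
  norm_sq_inner : ∀ x : X, ‖x‖ ^ 2 = ‖inner x x‖
  norm_inner_le : ∀ x y : X, ‖inner x y‖ ≤ ‖x‖ * ‖y‖
  norm_rsmul_le : ∀ (x : X) (a : A), ‖rsmul x a‖ ≤ ‖x‖ * ‖a‖

namespace HilbertModule

variable {A : Type*} [CStarAlgebra A] {X : Type*}
  [NormedAddCommGroup X] [NormedSpace ℂ X] [HilbertModule A X]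

/-- The closed submodule `X·S` generated by products `ξ·a`, `a ∈ S`. -/
def idealSub (X : Type*) {A : Type*} [CStarAlgebra A] [NormedAddCommGroup X]
    [NormedSpace ℂ X] [HilbertModule A X] (S : Set A) : Set X :=
  closure (Submodule.span ℂ {x : X | ∃ (ξ : X) (a : A), a ∈ S ∧ x = rsmul ξ a} : Set X)

/-- The rank-one ("theta") operator `ζ ↦ ξ⟨η,ζ⟩`. -/
def rankOne (A : Type*) {X : Type*} [CStarAlgebra A] [NormedAddCommGroup X]
    [NormedSpace ℂ X] [HilbertModule A X] (ξ η : X) : X →L[ℂ] X :=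
  LinearMap.mkContinuous
    { toFun := fun ζ => rsmul ξ (inner (A := A) η ζ)
      map_add' := fun x y => by
        show rsmul ξ (inner (A := A) η (x + y)) = _
        rw [inner_add_right, rsmul_add_right]
      map_smul' := fun c x => by
        show rsmul ξ (inner (A := A) η (c • x)) = _
        simp only [RingHom.id_apply]
        rw [inner_csmul_right, rsmul_csmul_right] }
    (‖ξ‖ * ‖η‖)
    (fun ζ => by
      calc ‖rsmul ξ (inner (A := A) η ζ)‖ ≤ ‖ξ‖ * ‖inner (A := A) η ζ‖ :=
            norm_rsmul_le _ _
        _ ≤ ‖ξ‖ * (‖η‖ * ‖ζ‖) :=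
            mul_le_mul_of_nonneg_left (norm_inner_le _ _) (norm_nonneg _)
        _ = ‖ξ‖ * ‖η‖ * ‖ζ‖ := (mul_assoc _ _ _).symm)

/-- The set of "compact" operators `K(X)`: the closed linear span of rank-one operators. -/
def compacts (A X : Type*) [CStarAlgebra A] [NormedAddCommGroup X]
    [NormedSpace ℂ X] [HilbertModule A X] : Set (X →L[ℂ] X) :=
  closure (Submodule.span ℂ {T : X →L[ℂ] X | ∃ ξ η : X, T = rankOne A ξ η} : Set (X →L[ℂ] X))

/-- `K(X·I)`, viewed inside the operators on `X`: the closed span of rank-one operators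
with both legs in the subset `S`. -/
def compactsOn (A : Type*) {X : Type*} [CStarAlgebra A] [NormedAddCommGroup X]
    [NormedSpace ℂ X] [HilbertModule A X] (S : Set X) : Set (X →L[ℂ] X) :=
  closure (Submodule.span ℂ
    {T : X →L[ℂ] X | ∃ ξ ∈ S, ∃ η ∈ S, T = rankOne A ξ η} : Set (X →L[ℂ] X))

/-- An operator is adjointable if it has an adjoint with respect to the `A`-valued
inner product. -/
def IsAdjointable (A : Type*) {X : Type*} [CStarAlgebra A] [NormedAddCommGroup X]
    [NormedSpace ℂ X] [HilbertModule A X] (S : X →L[ℂ] X) : Prop :=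
  ∃ T : X →L[ℂ] X, ∀ x y : X, inner (A := A) (S x) y = inner (A := A) x (T y)

end HilbertModule

/-- A C*-correspondence over `A`: a Hilbert `A`-module with a left action of `A`
by adjointable operators. -/
class Correspondence (A : Type*) [CStarAlgebra A] (X : Type*)
    [NormedAddCommGroup X] [NormedSpace ℂ X] extends HilbertModule A X where
  lsmul : A → X → X
  lsmul_add_left : ∀ (a b : A) (x : X), lsmul (a + b) x = lsmul a x + lsmul b x
  lsmul_add_right : ∀ (a : A) (x y : X), lsmul a (x + y) = lsmul a x + lsmul a y
  lsmul_mul : ∀ (a b : A) (x : X), lsmul (a * b) x = lsmul a (lsmul b x)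
  lsmul_csmul_left : ∀ (c : ℂ) (a : A) (x : X), lsmul (c • a) x = c • lsmul a x
  lsmul_csmul_right : ∀ (c : ℂ) (a : A) (x : X), lsmul a (c • x) = c • lsmul a x
  inner_lsmul_left : ∀ (a : A) (x y : X), inner (lsmul a x) y = inner x (lsmul (star a) y)
  lsmul_rsmul : ∀ (a : A) (x : X) (b : A), lsmul a (rsmul x b) = rsmul (lsmul a x) b
  norm_lsmul_le : ∀ (a : A) (x : X), ‖lsmul a x‖ ≤ ‖a‖ * ‖x‖

namespace Correspondence

open HilbertModule

variable {A : Type*} [CStarAlgebra A] {X : Type*}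
  [NormedAddCommGroup X] [NormedSpace ℂ X] [Correspondence A X]

/-- The left action `φ_X(a)` as a continuous linear operator on `X`. -/
def lact (A : Type*) {X : Type*} [CStarAlgebra A] [NormedAddCommGroup X]
    [NormedSpace ℂ X] [Correspondence A X] (a : A) : X →L[ℂ] X :=
  LinearMap.mkContinuous
    { toFun := lsmul a
      map_add' := lsmul_add_right a
      map_smul' := fun c x => by
        show lsmul a (c • x) = _
        simp only [RingHom.id_apply]; rw [lsmul_csmul_right] }
    ‖a‖ (norm_lsmul_le a)

/-- The ideal `X(S)`: closed span of `{⟨η, φ_X(a)ξ⟩ : a ∈ S}`. -/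
def corrApply (X : Type*) {A : Type*} [CStarAlgebra A] [NormedAddCommGroup X]
    [NormedSpace ℂ X] [Correspondence A X] (S : Set A) : Set A :=
  closure (Submodule.span ℂ
    {b : A | ∃ a ∈ S, ∃ ξ η : X, b = inner (A := A) η (lsmul a ξ)} : Set A)

/-- The ideal `X⁻¹(S) = {a : ⟨η, φ_X(a)ξ⟩ ∈ S for all ξ, η}`. -/
def corrInv (X : Type*) {A : Type*} [CStarAlgebra A] [NormedAddCommGroup X]
    [NormedSpace ℂ X] [Correspondence A X] (S : Set A) : Set A :=
  {a : A | ∀ ξ η : X, inner (A := A) η (lsmul a ξ) ∈ S}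

/-- The kernel of the left action `φ_X`. -/
def kerLact (X : Type*) {A : Type*} [CStarAlgebra A] [NormedAddCommGroup X]
    [NormedSpace ℂ X] [Correspondence A X] : Set A :=
  {a : A | ∀ ξ : X, lsmul a ξ = 0}

/-- Katsura's ideal `J_X = φ_X⁻¹(K(X)) ∩ (ker φ_X)^⊥`. -/
def JX (X : Type*) {A : Type*} [CStarAlgebra A] [NormedAddCommGroup X]
    [NormedSpace ℂ X] [Correspondence A X] : Set A :=
  {a : A | lact A (X := X) a ∈ compacts A X ∧ ∀ b ∈ kerLact X, a * b = 0}

end Correspondence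

open HilbertModule Correspondence

/-- Data presenting a Hilbert `B`-module `Y` as the quotient `X_I = X/XI` of a Hilbert
`A`-module `X` by a closed two-sided ideal `I` of `A` (with `B` playing the role of `A/I`). -/
structure QuotientData (A B : Type*) [CStarAlgebra A] [CStarAlgebra B]
    (I : TwoSidedIdeal A)
    (X Y : Type*) [NormedAddCommGroup X] [NormedSpace ℂ X] [HilbertModule A X]
    [NormedAddCommGroup Y] [NormedSpace ℂ Y] [HilbertModule B Y] : Type _ where
  π : A →⋆ₐ[ℂ] B
  π_surjective : Function.Surjective π
  π_ker : ∀ a : A, π a = 0 ↔ a ∈ I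
  q : X →ₗ[ℂ] Y
  q_surjective : Function.Surjective q
  q_ker : ∀ ξ : X, q ξ = 0 ↔ ξ ∈ idealSub X (I : Set A)
  q_inner : ∀ ξ ζ : X, inner (A := B) (q ξ) (q ζ) = π (inner (A := A) ξ ζ)
  q_rsmul : ∀ (ξ : X) (a : A), q (rsmul ξ a) = rsmul (q ξ) (π a)


/-- Quotient data compatible with the left actions (presenting `X_I` as a
C*-correspondence over `A/I`). -/
structure CorrQuotientData (A B : Type*) [CStarAlgebra A] [CStarAlgebra B]
    (I : TwoSidedIdeal A)
    (X Y : Type*) [NormedAddCommGroup X] [NormedSpace ℂ X] [Correspondence A X]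
    [NormedAddCommGroup Y] [NormedSpace ℂ Y] [Correspondence B Y]
    extends QuotientData A B I X Y where
  q_lsmul : ∀ (a : A) (ξ : X), q (lsmul a ξ) = lsmul (π a) (q ξ)

/-- Katsura's ideal `J(I) = {a : [φ_X(a)]_I ∈ K(X_I), a·X⁻¹(I) ⊂ I}`, expressed via
quotient data presenting `X_I`. -/
def JofI {A B : Type*} [CStarAlgebra A] [CStarAlgebra B] {I : TwoSidedIdeal A}
    {X Y : Type*} [NormedAddCommGroup X] [NormedSpace ℂ X] [Correspondence A X]
    [NormedAddCommGroup Y] [NormedSpace ℂ Y] [HilbertModule B Y]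
    (D : QuotientData A B I X Y) : Set A :=
  {a : A | (∃ T ∈ compacts B Y, ∀ ξ : X, T (D.q ξ) = D.q (lsmul a ξ)) ∧
    ∀ b ∈ corrInv X (I : Set A), a * b ∈ I}

/-- A Hilbert `A`-bimodule: a C*-correspondence together with a left inner product
satisfying `φ_X(⟪ξ,η⟫) = θ_{ξ,η}`. -/
class HilbertBimodule (A : Type*) [CStarAlgebra A] (X : Type*)
    [NormedAddCommGroup X] [NormedSpace ℂ X] extends Correspondence A X where
  linner : X → X → A
  lsmul_linner : ∀ ξ η ζ : X, lsmul (linner ξ η) ζ = rsmul ξ (inner η ζ)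

/-- The closed subspace `φ_X(S)X`: closed span of `{φ_X(a)ξ : a ∈ S}`. -/
def lsmulSet (X : Type*) {A : Type*} [CStarAlgebra A] [NormedAddCommGroup X]
    [NormedSpace ℂ X] [Correspondence A X] (S : Set A) : Set X :=
  closure (Submodule.span ℂ
    {x : X | ∃ a ∈ S, ∃ ξ : X, x = Correspondence.lsmul a ξ} : Set X)

open HilbertModule Correspondence

variable {A : Type*} [CStarAlgebra A] {X : Type*} [NormedAddCommGroup X]
  [NormedSpace ℂ X] [Correspondence A X]

/-- The iterates `X_{-n}(I)`: `X₀(I) = I`,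
`X_{-(n+1)}(I) = X_{-n}(I) + J_X ∩ X⁻¹(X_{-n}(I))`. -/
def corrNegIter (X : Type*) {A : Type*} [CStarAlgebra A] [NormedAddCommGroup X]
    [NormedSpace ℂ X] [Correspondence A X] (S : Set A) : ℕ → Set A
  | 0 => S
  | n + 1 => {a : A | ∃ b ∈ corrNegIter X S n,
      ∃ c ∈ JX X ∩ corrInv X (corrNegIter X S n), a = b + c}

/-- `X_{-∞}(I) = limₙ X_{-n}(I)`. -/
def corrNegIterLimit (X : Type*) {A : Type*} [CStarAlgebra A] [NormedAddCommGroup X]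
    [NormedSpace ℂ X] [Correspondence A X] (S : Set A) : Set A :=
  closure (⋃ n, corrNegIter X S n)

/-- The left action is multiplicative. -/
theorem aux_lact_mul (a b : A) : lact A (X := X) (a * b) = lact A a * lact A b := by
  ext x; exact lsmul_mul a b x

theorem aux_lact_norm (a : A) : ‖lact A (X := X) a‖ ≤ ‖a‖ :=
  LinearMap.mkContinuous_norm_le _ (norm_nonneg _) _

theorem aux_inner_lsmul_right (a : A) (x y : X) :
    HilbertModule.inner (A := A) x (lsmul a y)
      = HilbertModule.inner (A := A) (lsmul (star a) x) y := by
  rw [inner_lsmul_left, star_star]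

theorem aux_inner_zero_right (x : X) : HilbertModule.inner (A := A) x (0 : X) = 0 := by
  have := HilbertModule.inner_csmul_right (A := A) 0 x (0 : X)
  simpa using this

theorem aux_lsmul_zero_left (x : X) : lsmul (0 : A) x = 0 := by
  have := Correspondence.lsmul_csmul_left 0 (0 : A) x
  simpa using this

theorem aux_lsmul_zero_right (a : A) : lsmul a (0 : X) = 0 := by
  have := Correspondence.lsmul_csmul_right 0 a (0 : X)
  simpa using this

theorem aux_csmul_mem (K : TwoSidedIdeal A) (c : ℂ) {x : A} (h : x ∈ K) : c • x ∈ K := by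
  have := K.mul_mem_left (c • (1 : A)) x h
  simpa using this

theorem aux_lact_add (a b : A) : lact A (X := X) (a + b) = lact A a + lact A b := by
  ext x; exact lsmul_add_left a b x

theorem aux_lact_smul (c : ℂ) (a : A) : lact A (X := X) (c • a) = c • lact A a := by
  ext x; exact lsmul_csmul_left c a x

/-- The compacts as a submodule. -/
def auxCompacts (A X : Type*) [CStarAlgebra A] [NormedAddCommGroup X]
    [NormedSpace ℂ X] [HilbertModule A X] : Submodule ℂ (X →L[ℂ] X) :=
  (Submodule.span ℂ {T : X →L[ℂ] X | ∃ ξ η : X, T = rankOne A ξ η}).topologicalClosure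

theorem aux_mem_compacts (T : X →L[ℂ] X) : T ∈ compacts A X ↔ T ∈ auxCompacts A X := Iff.rfl

/-- Closed-submodule induction on compacts along a continuous linear map. -/
theorem aux_compacts_induction (N : Submodule ℂ (X →L[ℂ] X)) (hN : IsClosed (N : Set (X →L[ℂ] X)))
    (L : (X →L[ℂ] X) →L[ℂ] (X →L[ℂ] X))
    (h : ∀ ξ η : X, L (rankOne A ξ η) ∈ N) {T : X →L[ℂ] X} (hT : T ∈ compacts A X) :
    L T ∈ N := by
  have h1 : auxCompacts A X ≤ N.comap (L : (X →L[ℂ] X) →ₗ[ℂ] (X →L[ℂ] X)) := by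
    apply Submodule.topologicalClosure_minimal
    · rw [Submodule.span_le]
      rintro _ ⟨ξ, η, rfl⟩
      exact h ξ η
    · exact hN.preimage L.continuous
  exact h1 hT

theorem aux_compacts_closed : IsClosed (auxCompacts A X : Set (X →L[ℂ] X)) :=
  Submodule.isClosed_topologicalClosure _

theorem aux_rankOne_mem (ξ η : X) : rankOne A ξ η ∈ auxCompacts A X :=
  Submodule.le_topologicalClosure _ (Submodule.subset_span ⟨ξ, η, rfl⟩)

theorem aux_lact_comp_compacts (a : A) {T : X →L[ℂ] X} (hT : T ∈ compacts A X) :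
    lact A a * T ∈ compacts A X := by
  refine aux_compacts_induction (auxCompacts A X) aux_compacts_closed
    (ContinuousLinearMap.mul ℂ (X →L[ℂ] X) (lact A a)) (fun ξ η => ?_) hT
  have : (ContinuousLinearMap.mul ℂ (X →L[ℂ] X) (lact A a)) (rankOne A ξ η)
      = rankOne A (lsmul a ξ) η := by
    ext ζ
    exact lsmul_rsmul a ξ _
  rw [this]; exact aux_rankOne_mem _ _

theorem aux_compacts_comp_lact (a : A) {T : X →L[ℂ] X} (hT : T ∈ compacts A X) :
    T * lact A a ∈ compacts A X := by
  refine aux_compacts_induction (auxCompacts A X) aux_compacts_closed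
    ((ContinuousLinearMap.mul ℂ (X →L[ℂ] X)).flip (lact A a)) (fun ξ η => ?_) hT
  have : ((ContinuousLinearMap.mul ℂ (X →L[ℂ] X)).flip (lact A a)) (rankOne A ξ η)
      = rankOne A ξ (lsmul (star a) η) := by
    ext ζ
    show rsmul ξ (HilbertModule.inner (A := A) η (lsmul a ζ)) = rsmul ξ (HilbertModule.inner _ ζ)
    rw [aux_inner_lsmul_right]
  rw [this]; exact aux_rankOne_mem _ _

theorem aux_JX_mul_left (a : A) {b : A} (hb : b ∈ JX (A := A) X) : a * b ∈ JX (A := A) X := by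
  refine ⟨?_, fun k hk => ?_⟩
  · rw [aux_lact_mul]; exact aux_lact_comp_compacts a hb.1
  · rw [mul_assoc, hb.2 k hk, mul_zero]

theorem aux_JX_mul_right {a : A} (b : A) (ha : a ∈ JX (A := A) X) : a * b ∈ JX (A := A) X := by
  refine ⟨?_, fun k hk => ?_⟩
  · rw [aux_lact_mul]; exact aux_compacts_comp_lact b ha.1
  · rw [mul_assoc]
    refine ha.2 _ fun ξ => ?_
    rw [lsmul_mul, hk, aux_lsmul_zero_right]

theorem aux_JX_add {a b : A} (ha : a ∈ JX (A := A) X) (hb : b ∈ JX (A := A) X) :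
    a + b ∈ JX (A := A) X := by
  refine ⟨?_, fun k hk => ?_⟩
  · rw [aux_lact_add]; exact (auxCompacts A X).add_mem ha.1 hb.1
  · rw [add_mul, ha.2 k hk, hb.2 k hk, add_zero]

theorem aux_JX_zero : (0 : A) ∈ JX (A := A) X := by
  refine ⟨?_, fun k hk => zero_mul k⟩
  have : lact A (X := X) (0 : A) = 0 := by ext x; exact aux_lsmul_zero_left x
  rw [this]; exact (auxCompacts A X).zero_mem

theorem aux_inv_mul_left (K : TwoSidedIdeal A) (a : A) {b : A}
    (hb : b ∈ corrInv X (K : Set A)) : a * b ∈ corrInv X (K : Set A) := by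
  intro ξ η
  rw [lsmul_mul, aux_inner_lsmul_right]
  exact hb _ _

theorem aux_inv_mul_right (K : TwoSidedIdeal A) {a : A} (b : A)
    (ha : a ∈ corrInv X (K : Set A)) : a * b ∈ corrInv X (K : Set A) := by
  intro ξ η
  rw [lsmul_mul]
  exact ha _ _

theorem aux_inv_add (K : TwoSidedIdeal A) {a b : A}
    (ha : a ∈ corrInv X (K : Set A)) (hb : b ∈ corrInv X (K : Set A)) :
    a + b ∈ corrInv X (K : Set A) := by
  intro ξ η
  rw [lsmul_add_left, HilbertModule.inner_add_right]
  exact K.add_mem (ha _ _) (hb _ _)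

theorem aux_inv_zero (K : TwoSidedIdeal A) : (0 : A) ∈ corrInv X (K : Set A) := by
  intro ξ η
  rw [aux_lsmul_zero_left, aux_inner_zero_right]
  exact K.zero_mem

/-- One step of the iteration, as an ideal. -/
def auxStep (X : Type*) {A : Type*} [CStarAlgebra A] [NormedAddCommGroup X]
    [NormedSpace ℂ X] [Correspondence A X] (K : TwoSidedIdeal A) : TwoSidedIdeal A :=
  TwoSidedIdeal.mk' {a : A | ∃ b ∈ (K : Set A), ∃ c ∈ JX X ∩ corrInv X (K : Set A), a = b + c}
    ⟨0, K.zero_mem, 0, ⟨aux_JX_zero, aux_inv_zero K⟩, by simp⟩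
    (by
      rintro _ _ ⟨b, hb, c, hc, rfl⟩ ⟨b', hb', c', hc', rfl⟩
      exact ⟨b + b', K.add_mem hb hb', c + c', ⟨aux_JX_add hc.1 hc'.1, aux_inv_add K hc.2 hc'.2⟩,
        by abel⟩)
    (by
      rintro _ ⟨b, hb, c, hc, rfl⟩
      refine ⟨-b, K.neg_mem hb, (-1) * c, ⟨aux_JX_mul_left _ hc.1, aux_inv_mul_left K _ hc.2⟩, ?_⟩
      simp; abel)
    (by
      rintro x _ ⟨b, hb, c, hc, rfl⟩
      exact ⟨x * b, K.mul_mem_left _ _ hb, x * c,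
        ⟨aux_JX_mul_left _ hc.1, aux_inv_mul_left K _ hc.2⟩, mul_add _ _ _⟩)
    (by
      rintro _ x ⟨b, hb, c, hc, rfl⟩
      exact ⟨b * x, K.mul_mem_right _ _ hb, c * x,
        ⟨aux_JX_mul_right _ hc.1, aux_inv_mul_right K _ hc.2⟩, add_mul _ _ _⟩)

/-- The iterates as ideals. -/
def auxSeq (X : Type*) {A : Type*} [CStarAlgebra A] [NormedAddCommGroup X]
    [NormedSpace ℂ X] [Correspondence A X] (I : TwoSidedIdeal A) : ℕ → TwoSidedIdeal A
  | 0 => I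
  | n + 1 => auxStep X (auxSeq X I n)

theorem aux_seq_coe (I : TwoSidedIdeal A) (n : ℕ) :
    (auxSeq X I n : Set A) = corrNegIter X (I : Set A) n := by
  induction n with
  | zero => rfl
  | succ n ih =>
    rw [auxSeq, corrNegIter, ← ih, auxStep]
    exact TwoSidedIdeal.coe_mk' _ _ _ _ _ _

theorem aux_mem_seq_succ (I : TwoSidedIdeal A) (n : ℕ) (a : A) :
    a ∈ auxSeq X I (n + 1) ↔ ∃ b ∈ auxSeq X I n,
      ∃ c ∈ JX X ∩ corrInv X (auxSeq X I n : Set A), a = b + c := by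
  rw [← SetLike.mem_coe, aux_seq_coe, corrNegIter, ← aux_seq_coe]
  rfl

theorem aux_seq_mono (I : TwoSidedIdeal A) : Monotone (auxSeq X I) := by
  refine monotone_nat_of_le_succ fun n a ha => ?_
  rw [aux_mem_seq_succ]
  exact ⟨a, ha, 0, ⟨aux_JX_zero, aux_inv_zero _⟩, (add_zero a).symm⟩

theorem aux_limit_eq (I : TwoSidedIdeal A) :
    corrNegIterLimit X (I : Set A) = closure (⋃ n, (auxSeq X I n : Set A)) := by
  simp only [corrNegIterLimit, aux_seq_coe]

/-- The union of the iterates. -/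
theorem aux_union_add (I : TwoSidedIdeal A) {a b : A}
    (ha : a ∈ ⋃ n, (auxSeq X I n : Set A)) (hb : b ∈ ⋃ n, (auxSeq X I n : Set A)) :
    a + b ∈ ⋃ n, (auxSeq X I n : Set A) := by
  obtain ⟨n, hn⟩ := Set.mem_iUnion.1 ha
  obtain ⟨m, hm⟩ := Set.mem_iUnion.1 hb
  exact Set.mem_iUnion.2 ⟨max n m, (auxSeq X I (max n m)).add_mem
    (aux_seq_mono I (le_max_left n m) hn) (aux_seq_mono I (le_max_right n m) hm)⟩

theorem aux_union_map (I : TwoSidedIdeal A) (f : A → A) (hf : Continuous f)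
    (h : ∀ (K : TwoSidedIdeal A), ∀ a ∈ K, f a ∈ K) {a : A}
    (ha : a ∈ closure (⋃ n, (auxSeq X I n : Set A))) :
    f a ∈ closure (⋃ n, (auxSeq X I n : Set A)) := by
  refine map_mem_closure hf ha fun x hx => ?_
  obtain ⟨n, hn⟩ := Set.mem_iUnion.1 hx
  exact Set.mem_iUnion.2 ⟨n, h _ _ hn⟩

/-- The limit as an ideal. -/
def auxLim (X : Type*) {A : Type*} [CStarAlgebra A] [NormedAddCommGroup X]
    [NormedSpace ℂ X] [Correspondence A X] (I : TwoSidedIdeal A) : TwoSidedIdeal A :=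
  TwoSidedIdeal.mk' (closure (⋃ n, (auxSeq X I n : Set A)))
    (subset_closure (Set.mem_iUnion.2 ⟨0, TwoSidedIdeal.zero_mem _⟩))
    (fun ha hb => map_mem_closure₂ continuous_add ha hb fun _ hx _ hy => aux_union_add I hx hy)
    (fun ha => aux_union_map I _ continuous_neg (fun K _ h => K.neg_mem h) ha)
    (fun {x _} ha => aux_union_map I _ (continuous_const_mul x)
      (fun K _ h => K.mul_mem_left _ _ h) ha)
    (fun {_ y} ha => aux_union_map I (fun t => t * y) (continuous_mul_const y)
      (fun K _ h => K.mul_mem_right _ _ h) ha)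

theorem aux_lim_coe (I : TwoSidedIdeal A) :
    (auxLim X I : Set A) = corrNegIterLimit X (I : Set A) := by
  rw [aux_limit_eq, auxLim]
  exact TwoSidedIdeal.coe_mk' _ _ _ _ _ _

/-- Operators all of whose matrix coefficients lie in `K`. -/
def auxOps (X : Type*) {A : Type*} [CStarAlgebra A] [NormedAddCommGroup X]
    [NormedSpace ℂ X] [Correspondence A X] (K : TwoSidedIdeal A) :
    Submodule ℂ (X →L[ℂ] X) where
  carrier := {T | ∀ ξ η : X, HilbertModule.inner (A := A) η (T ξ) ∈ K}
  zero_mem' := fun ξ η => by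
    show HilbertModule.inner (A := A) η (0 : X) ∈ K
    rw [aux_inner_zero_right]; exact K.zero_mem
  add_mem' := fun {S T} hS hT ξ η => by
    show HilbertModule.inner (A := A) η (S ξ + T ξ) ∈ K
    rw [HilbertModule.inner_add_right]; exact K.add_mem (hS _ _) (hT _ _)
  smul_mem' := fun c T hT ξ η => by
    show HilbertModule.inner (A := A) η (c • T ξ) ∈ K
    rw [inner_csmul_right]; exact aux_csmul_mem K c (hT _ _)

theorem aux_ops_mul_right (K : TwoSidedIdeal A) {T : X →L[ℂ] X} (S : X →L[ℂ] X)
    (hT : T ∈ auxOps X K) : T * S ∈ auxOps X K :=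
  fun ξ η => hT (S ξ) η

theorem aux_ops_lact_mul (K : TwoSidedIdeal A) (a : A) {T : X →L[ℂ] X}
    (hT : T ∈ auxOps X K) : lact A a * T ∈ auxOps X K := fun ξ η => by
  show HilbertModule.inner (A := A) η (lsmul a (T ξ)) ∈ K
  rw [aux_inner_lsmul_right]
  exact hT ξ _

/-- The closed union of the `auxOps`. -/
def auxN (X : Type*) {A : Type*} [CStarAlgebra A] [NormedAddCommGroup X]
    [NormedSpace ℂ X] [Correspondence A X] (I : TwoSidedIdeal A) : Submodule ℂ (X →L[ℂ] X) :=
  (⨆ n, auxOps X (auxSeq X I n)).topologicalClosure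

theorem aux_N_approx (I : TwoSidedIdeal A) {T : X →L[ℂ] X} (hT : T ∈ auxN X I)
    {ε : ℝ} (hε : 0 < ε) : ∃ n, ∃ k ∈ auxOps X (auxSeq X I n), ‖T - k‖ < ε := by
  have h1 : T ∈ closure ((⨆ n, auxOps X (auxSeq X I n) : Submodule ℂ (X →L[ℂ] X)) :
    Set (X →L[ℂ] X)) := hT
  obtain ⟨k, hk, hd⟩ := Metric.mem_closure_iff.1 h1 ε hε
  have hmono : Monotone fun n => auxOps X (auxSeq X I n) :=
    fun n m h T hT ξ η => aux_seq_mono I h (hT ξ η)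
  obtain ⟨n, hn⟩ := (Submodule.mem_iSup_of_directed _ hmono.directed_le).1 hk
  exact ⟨n, k, hn, by rwa [← dist_eq_norm]⟩

theorem aux_rankOne_N (I : TwoSidedIdeal A) (ξ η : X) {x : A}
    (hx : x ∈ closure (⋃ n, (auxSeq X I n : Set A))) :
    rankOne A (rsmul ξ x) η ∈ auxN X I := by
  -- the assignment is linear and bounded
  let L : A →L[ℂ] (X →L[ℂ] X) := LinearMap.mkContinuous
    { toFun := fun x => rankOne A (rsmul ξ x) η
      map_add' := fun x y => by
        ext ζ
        show rsmul (rsmul ξ (x + y)) _ = rsmul (rsmul ξ x) _ + rsmul (rsmul ξ y) _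
        rw [rsmul_add_right, rsmul_add_left]
      map_smul' := fun c x => by
        ext ζ
        show rsmul (rsmul ξ (c • x)) _ = c • rsmul (rsmul ξ x) _
        rw [rsmul_csmul_right, rsmul_csmul_left] } (‖ξ‖ * ‖η‖) (fun x => by
        have h0 : ‖rankOne A (rsmul ξ x) η‖ ≤ ‖rsmul ξ x‖ * ‖η‖ :=
          LinearMap.mkContinuous_norm_le _ (mul_nonneg (norm_nonneg _) (norm_nonneg _)) _
        refine h0.trans ?_
        have := norm_rsmul_le ξ x
        nlinarith [norm_nonneg η])
  have : L x ∈ closure ((⨆ n, auxOps X (auxSeq X I n) : Submodule ℂ (X →L[ℂ] X)) :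
      Set (X →L[ℂ] X)) := by
    refine map_mem_closure L.continuous hx fun y hy => ?_
    obtain ⟨n, hn⟩ := Set.mem_iUnion.1 hy
    refine Submodule.mem_iSup_of_mem n fun ζ θ => ?_
    show HilbertModule.inner (A := A) θ (rsmul (rsmul ξ y) _) ∈ _
    rw [inner_rsmul_right, inner_rsmul_right]
    exact TwoSidedIdeal.mul_mem_right _ _ _ (TwoSidedIdeal.mul_mem_left _ _ _ hn)
  exact this

theorem aux_cube (I : TwoSidedIdeal A) {b : A} (hJ : b ∈ JX (A := A) X)
    (hb : b ∈ corrInv X (closure (⋃ n, (auxSeq X I n : Set A)))) :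
    lact A (X := X) (b ^ 3) ∈ auxN X I := by
  have hcl : IsClosed (auxN X I : Set (X →L[ℂ] X)) := Submodule.isClosed_topologicalClosure _
  have h1 : ∀ ξ η ξ' η' : X,
      rankOne A ξ η * (lact A b * rankOne A ξ' η') ∈ auxN X I := by
    intro ξ η ξ' η'
    have : rankOne A ξ η * (lact A b * rankOne A ξ' η')
        = rankOne A (rsmul ξ (HilbertModule.inner (A := A) η (lsmul b ξ'))) η' := by
      ext ζ
      show rsmul ξ (HilbertModule.inner (A := A) η (lsmul b (rsmul ξ' _))) = rsmul (rsmul ξ _) _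
      rw [lsmul_rsmul, inner_rsmul_right, rsmul_rsmul]
    rw [this]
    exact aux_rankOne_N I _ _ (hb _ _)
  have h2 : ∀ ξ' η' : X, lact A b * (lact A b * rankOne A ξ' η') ∈ auxN X I := fun ξ' η' =>
    aux_compacts_induction (auxN X I) hcl
      ((ContinuousLinearMap.mul ℂ (X →L[ℂ] X)).flip (lact A b * rankOne A ξ' η'))
      (fun ξ η => h1 ξ η ξ' η') hJ.1
  have h3 : (lact A b * lact A b) * lact A b ∈ auxN X I :=
    aux_compacts_induction (auxN X I) hcl
      (ContinuousLinearMap.mul ℂ (X →L[ℂ] X) (lact A b * lact A b))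
      (fun ξ' η' => by
        have := h2 ξ' η'
        rw [← mul_assoc] at this
        exact this) hJ.1
  have : b ^ 3 = (b * b) * b := by rw [pow_succ, pow_two]
  rwa [this, aux_lact_mul, aux_lact_mul]

/-- The Neumann series step. -/
theorem aux_neumann [CompleteSpace X] (I : TwoSidedIdeal A) {T c g : A}
    (hT : lact A (X := X) T ∈ auxN X I) (hc : c * g * T = c) :
    ∃ n, c ∈ corrInv X (auxSeq X I n : Set A) := by
  have hpos : 0 < 1 / (‖g‖ + 1) := by positivity
  obtain ⟨n, k, hk, hlt⟩ := aux_N_approx I hT hpos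
  refine ⟨n, ?_⟩
  set R : X →L[ℂ] X := lact A g * (lact A T - k) with hR
  have hR1 : ‖R‖ < 1 := by
    calc ‖R‖ ≤ ‖lact A (X := X) g‖ * ‖lact A T - k‖ := norm_mul_le _ _
      _ ≤ ‖g‖ * (1 / (‖g‖ + 1)) :=
        mul_le_mul (aux_lact_norm g) hlt.le (norm_nonneg _) (norm_nonneg _)
      _ < 1 := by
        rw [mul_one_div, div_lt_one (by positivity)]; linarith
  let u := Units.oneSub R hR1
  have hu : lact A (X := X) c * (1 - R) = lact A (c * g) * k := by
    have e : lact A (X := X) c = lact A c * lact A g * lact A T := by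
      rw [← aux_lact_mul, ← aux_lact_mul, hc]
    rw [aux_lact_mul, hR]
    have : lact A (X := X) c * (1 - lact A g * (lact A T - k))
      = lact A c - lact A c * lact A g * lact A T + lact A c * lact A g * k := by noncomm_ring
    rw [this, ← e]; simp
  have hfin : lact A (X := X) c = lact A (c * g) * k * (↑u⁻¹ : X →L[ℂ] X) := by
    rw [← hu]
    have : (1 - R) = (u : X →L[ℂ] X) := rfl
    rw [this, Units.mul_inv_cancel_right]
  have : lact A (X := X) c ∈ auxOps X (auxSeq X I n) := by
    rw [hfin]
    exact aux_ops_mul_right _ _ (aux_ops_lact_mul _ _ hk)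
  exact fun ξ η => this ξ η

/-- Cut-off functions. -/
theorem aux_cutoff {ε : ℝ} (hε : 0 < ε) : ∃ f g : ℝ → ℝ, Continuous f ∧ Continuous g ∧
    (∀ t, f t * g t * t ^ 3 = f t) ∧ (∀ t, 0 ≤ f t) ∧ (∀ t, f t ≤ 1) ∧
    (∀ t, 2 * ε ≤ t → f t = 1) := by
  refine ⟨fun t => min 1 (max 0 (t / ε - 1)), fun t => ((max t ε) ^ 3)⁻¹, by fun_prop, ?_, ?_,
    fun t => le_min zero_le_one (le_max_left _ _), fun t => min_le_left _ _, ?_⟩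
  · refine Continuous.inv₀ (by fun_prop) fun t => ?_
    have : 0 < max t ε := lt_max_of_lt_right hε
    positivity
  · intro t
    rcases le_total t ε with h | h
    · have : t / ε - 1 ≤ 0 := by
        rw [sub_nonpos, div_le_one hε]; exact h
      simp [max_eq_left this]
    · have : 0 < t := hε.trans_le h
      simp only [max_eq_left h]
      rw [mul_assoc, inv_mul_cancel₀ (by positivity), mul_one]
  · intro t h
    refine min_eq_left (le_max_of_le_right ?_)
    have : 2 ≤ t / ε := by rwa [le_div_iff₀ hε]
    linarith

/-- Cut-off elements. -/
theorem aux_cfc (a : A) {ε : ℝ} (hε : 0 < ε) : ∃ c g : A,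
    c * g * (star a * a) ^ 3 = c ∧ c = star a * a * (c * g * (star a * a) ^ 2) ∧
    ‖a - a * c‖ ^ 2 ≤ 2 * ε := by
  obtain ⟨f, g, hf, hg, hfg, hf0, hf1, hf2⟩ := aux_cutoff hε
  obtain ⟨b, hb⟩ : ∃ b, b = star a * a := ⟨_, rfl⟩
  rw [← hb]
  have hsa : IsSelfAdjoint b := hb ▸ IsSelfAdjoint.star_mul_self a
  have cmul : ∀ u v : ℝ → ℝ, Continuous u → Continuous v →
      cfc (fun t => u t * v t) b = cfc u b * cfc v b :=
    fun u v hu hv => cfc_mul u v b hu.continuousOn hv.continuousOn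
  have hpow : ∀ n : ℕ, cfc (fun t : ℝ => t ^ n) b = b ^ n := fun n => cfc_pow_id b n hsa
  have hid : cfc (fun t : ℝ => t) b = b := cfc_id' ℝ b hsa
  have hc1 : cfc f b * cfc g b * b ^ 3 = cfc f b := by
    rw [← hpow 3, ← cmul f g hf hg, ← cmul (fun t => f t * g t) (fun t => t ^ 3) (hf.mul hg) (continuous_pow 3)]
    simp only [hfg]
  refine ⟨cfc f b, cfc g b, hc1, ?_, ?_⟩
  · have h2 : cfc f b = cfc (fun t : ℝ => t * (f t * g t * t ^ 2)) b := by
      congr 1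
      funext t
      have := hfg t
      linarith
    rw [cmul (fun t => t) (fun t => f t * g t * t ^ 2) continuous_id'
      ((hf.mul hg).mul (continuous_pow 2)),
      cmul (fun t => f t * g t) (fun t => t ^ 2) (hf.mul hg) (continuous_pow 2), cmul f g hf hg, hpow, hid] at h2
    exact h2
  · have hf' : Continuous fun t => 1 - f t := continuous_const.sub hf
    have h1 : cfc (fun t => 1 - f t) b = 1 - cfc f b := by
      rw [cfc_sub (fun _ => (1 : ℝ)) f b continuousOn_const hf.continuousOn, cfc_const_one ℝ b hsa]
    have hs : IsSelfAdjoint (1 - cfc f b) := by rw [← h1]; exact cfc_predicate _ b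
    have h2 : star (a - a * cfc f b) * (a - a * cfc f b)
        = cfc (fun t => (1 - f t) * t * (1 - f t)) b := by
      have e : a - a * cfc f b = a * (1 - cfc f b) := by rw [mul_sub, mul_one]
      rw [cmul (fun t => (1 - f t) * t) (fun t => 1 - f t) (hf'.mul continuous_id') hf',
        cmul (fun t => 1 - f t) (fun t => t) hf' continuous_id', h1, hid, e,
        star_mul, hs.star_eq]
      conv_rhs => enter [1, 2]; rw [hb]
      simp only [mul_assoc]
    rw [pow_two, ← CStarRing.norm_star_mul_self, h2]
    refine norm_cfc_le (by positivity) fun t ht => ?_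
    have ht0 : 0 ≤ t := by
      rw [hb] at ht
      exact spectrum_star_mul_self_nonneg t ht
    have hf0 := hf0 t
    have hf1 := hf1 t
    rw [Real.norm_eq_abs, abs_of_nonneg (mul_nonneg (mul_nonneg (by linarith) ht0) (by linarith))]
    rcases le_total t (2 * ε) with h | h
    · have h3 : (1 - f t) * t ≤ t := by nlinarith
      have h4 : 0 ≤ (1 - f t) * t := mul_nonneg (by linarith) ht0
      nlinarith
    · rw [hf2 t h]; simp; positivity

theorem aux_neg_inv [CompleteSpace X] (I : TwoSidedIdeal A) {a : A} (hJ : a ∈ JX (A := A) X)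
    (ha : a ∈ corrInv X (auxLim X I : Set A)) :
    a ∈ closure (⋃ n, (auxSeq X I n : Set A)) := by
  rw [Metric.mem_closure_iff]
  intro δ hδ
  obtain ⟨c, g, h1, h2, h3⟩ := aux_cfc a (ε := δ ^ 2 / 4) (by positivity)
  have hbJ : star a * a ∈ JX (A := A) X := aux_JX_mul_left _ hJ
  have hb : star a * a ∈ corrInv X (closure (⋃ n, (auxSeq X I n : Set A))) := by
    have := aux_inv_mul_left (X := X) (auxLim X I) (star a) ha
    rwa [aux_lim_coe, aux_limit_eq] at this
  obtain ⟨n, hn⟩ := aux_neumann I (aux_cube I hbJ hb) h1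
  have hcJ : c ∈ JX (A := A) X := by rw [h2]; exact aux_JX_mul_right _ hbJ
  refine ⟨a * c, Set.mem_iUnion.2 ⟨n + 1, ?_⟩, ?_⟩
  · refine (aux_mem_seq_succ I n _).2 ⟨0, TwoSidedIdeal.zero_mem _, a * c,
      ⟨aux_JX_mul_left _ hcJ, aux_inv_mul_left _ _ hn⟩, (zero_add _).symm⟩
  · rw [dist_eq_norm]
    refine lt_of_pow_lt_pow_left₀ 2 hδ.le ?_
    have : 0 < δ ^ 2 := by positivity
    linarith

/-- `X_{-∞}(I)` is the smallest negatively invariant (closed two-sided)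
ideal of `A` containing `I`. -/
theorem stmt11 [CompleteSpace X] (I : TwoSidedIdeal A) (hI : IsClosed (I : Set A)) :
    (∃ K : TwoSidedIdeal A, (K : Set A) = corrNegIterLimit X (I : Set A)) ∧
    IsClosed (corrNegIterLimit X (I : Set A)) ∧
    (I : Set A) ⊆ corrNegIterLimit X (I : Set A) ∧
    JX X ∩ corrInv X (corrNegIterLimit X (I : Set A)) ⊆ corrNegIterLimit X (I : Set A) ∧
    (∀ K : TwoSidedIdeal A, IsClosed (K : Set A) → (I : Set A) ⊆ (K : Set A) →
      JX X ∩ corrInv X (K : Set A) ⊆ (K : Set A) →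
      corrNegIterLimit X (I : Set A) ⊆ (K : Set A)) := by
  refine ⟨⟨auxLim X I, aux_lim_coe I⟩, isClosed_closure, ?_, ?_, ?_⟩
  · exact fun a ha => subset_closure (Set.mem_iUnion.2 ⟨0, ha⟩)
  · rintro a ⟨hJ, ha⟩
    rw [aux_limit_eq]
    rw [← aux_lim_coe] at ha
    exact aux_neg_inv I hJ ha
  · intro K hK hIK hneg
    refine closure_minimal (Set.iUnion_subset fun n => ?_) hK
    induction n with
    | zero => exact hIK
    | succ n ih =>
      rintro _ ⟨b, hb, c, hc, rfl⟩
      exact K.add_mem (ih hb) (hneg ⟨hc.1, fun ξ η => ih (hc.2 ξ η)⟩)
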